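/- arXiv:1710.07851 — 2 statements merged into one kernel-verified Lean document; each statement's English description precedes it below -/
import Mathlib

section
/- For a partition λ of L with at most N rows, the Schur polynomial evaluated at N ones satisfies s_λ(1,...,1) = Π_{(i,j)∈λ} (N + j - i) / hook_λ(i,j), where hook_λ(i,j) is the hook length at cell (i,j) of the Young diagram of λ. -/
/-- The hook length of the cell `c = (i, j)` of the Young diagram `μ`:
`hook_μ(i,j) = (λ_i - j) + (λ'_j - i) - 1` (arm + leg + 1, here with 0-based `i, j`). -/
def hookLength (μ : YoungDiagram) (c : ℕ × ℕ) : ℕ :=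
  (μ.rowLen c.1 - c.2) + (μ.colLen c.2 - c.1) - 1

/-- `T` is a semistandard filling, with entries `< n` and extended by zero, of the left-justified
array whose `i`-th row has length `l i`. -/
structure IsSemistandard (l : ℕ → ℕ) (n : ℕ) (T : ℕ → ℕ → ℕ) : Prop where
  row_weak : ∀ {i j₁ j₂ : ℕ}, j₁ < j₂ → j₂ < l i → T i j₁ ≤ T i j₂
  col_strict : ∀ {i₁ i₂ j : ℕ}, i₁ < i₂ → j < l i₂ → T i₁ j < T i₂ j
  zeros : ∀ {i j : ℕ}, l i ≤ j → T i j = 0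
  bound : ∀ {i j : ℕ}, j < l i → T i j < n

namespace IsSemistandard

variable {l : ℕ → ℕ} {n : ℕ} {T : ℕ → ℕ → ℕ}

theorem exists_not_lt (l : ℕ → ℕ) (n : ℕ) (T : ℕ → ℕ → ℕ) (i : ℕ) :
    ∃ j, ¬ (j < l i ∧ T i j < n) :=
  ⟨l i, fun h => lt_irrefl _ h.1⟩

/-- The length of the initial segment of row `i` of `T` with entries `< n`. -/
def truncLen (l : ℕ → ℕ) (n : ℕ) (T : ℕ → ℕ → ℕ) (i : ℕ) : ℕ :=
  Nat.find (exists_not_lt l n T i)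

theorem lt_truncLen_iff (h : IsSemistandard l (n + 1) T) {i j : ℕ} :
    j < truncLen l n T i ↔ j < l i ∧ T i j < n := by
  refine ⟨fun hj => not_not.1 (Nat.find_min (exists_not_lt l n T i) hj), fun hj => ?_⟩
  by_contra hle
  rw [not_lt] at hle
  have hs := Nat.find_spec (exists_not_lt l n T i)
  change ¬ (truncLen l n T i < l i ∧ T i (truncLen l n T i) < n) at hs
  refine hs ⟨hle.trans_lt hj.1, ?_⟩
  rcases hle.eq_or_lt with he | hlt
  · rw [he]; exact hj.2
  · exact (h.row_weak hlt hj.1).trans_lt hj.2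

theorem le_apply (h : IsSemistandard l n T) (hl : Antitone l) {i j : ℕ} (hj : j < l i) :
    i ≤ T i j := by
  induction i with
  | zero => exact Nat.zero_le _
  | succ i ih =>
    exact Nat.succ_le_of_lt
      ((ih (hj.trans_le (hl i.le_succ))).trans_lt (h.col_strict i.lt_succ_self hj))

theorem truncLen_le (h : IsSemistandard l (n + 1) T) (i : ℕ) : truncLen l n T i ≤ l i := by
  by_contra! hlt
  exact lt_irrefl _ (h.lt_truncLen_iff.1 hlt).1

theorem le_truncLen (h : IsSemistandard l (n + 1) T) (hl : Antitone l) (i : ℕ) :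
    l (i + 1) ≤ truncLen l n T i := by
  by_contra! hlt
  refine lt_irrefl _ (h.lt_truncLen_iff.2 ⟨hlt.trans_le (hl i.le_succ), ?_⟩)
  exact (h.col_strict i.lt_succ_self hlt).trans_le (Nat.lt_succ_iff.1 (h.bound hlt))

theorem truncLen_eq_zero (h : IsSemistandard l (n + 1) T) (hl : Antitone l) {i : ℕ}
    (hi : n ≤ i) : truncLen l n T i = 0 := by
  by_contra hne
  obtain ⟨h0, hlt⟩ := h.lt_truncLen_iff.1 (Nat.pos_of_ne_zero hne)
  exact (hlt.trans_le hi).not_ge (h.le_apply hl h0)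

theorem restrict {m : ℕ → ℕ} (h : IsSemistandard l (n + 1) T) (hm : Antitone m)
    (hml : ∀ i, m i ≤ l i) (hT : ∀ i j, j < m i → T i j < n) :
    IsSemistandard m n fun i j => if j < m i then T i j else 0 where
  row_weak {i j₁ j₂} hj hj₂ := by
    simpa only [if_pos hj₂, if_pos (hj.trans hj₂)] using h.row_weak hj (hj₂.trans_le (hml i))
  col_strict {i₁ i₂ j} hi hj := by
    simpa only [if_pos hj, if_pos (hj.trans_le (hm hi.le))] using
      h.col_strict hi (hj.trans_le (hml i₂))
  zeros hj := if_neg hj.not_gt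
  bound {i j} hj := by simpa only [if_pos hj] using hT i j hj

theorem extend {m : ℕ → ℕ} (h : IsSemistandard m n T) (hl : Antitone l)
    (hml : ∀ i, m i ≤ l i) (hlm : ∀ i, l (i + 1) ≤ m i) :
    IsSemistandard l (n + 1)
      fun i j => if j < m i then T i j else if j < l i then n else 0 where
  row_weak {i j₁ j₂} hj hj₂ := by
    rw [if_pos hj₂, if_pos (hj.trans hj₂)]
    split_ifs with h₁ h₂ h₂
    · exact h.row_weak hj h₂
    · exact (h.bound h₁).le
    · exact absurd (hj.trans h₂) h₁
    · exact le_rfl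
  col_strict {i₁ i₂ j} hi hj := by
    have h₁ : j < m i₁ := hj.trans_le ((hl hi).trans (hlm i₁))
    rw [if_pos hj, if_pos h₁]
    split_ifs with h₂
    · exact h.col_strict hi h₂
    · exact h.bound h₁
  zeros {i j} hj := by rw [if_neg ((hml i).trans hj).not_gt, if_neg hj.not_gt]
  bound {i j} hj := by
    rw [if_pos hj]
    split_ifs with h₁
    · exact (h.bound h₁).trans n.lt_succ_self
    · exact n.lt_succ_self

/-- Semistandard fillings of `l` with entries `< n + 1` whose entries `< n` occupy the shape `m`
are the semistandard fillings of `m` with entries `< n`. -/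
def fiberEquiv {m : ℕ → ℕ} (hl : Antitone l) (hml : ∀ i, m i ≤ l i) (hlm : ∀ i, l (i + 1) ≤ m i) :
    {T : {T // IsSemistandard l (n + 1) T} // truncLen l n T.1 = m} ≃
      {T // IsSemistandard m n T} where
  toFun T := ⟨_, T.1.2.restrict
    (antitone_nat_of_succ_le fun i => (hml (i + 1)).trans (hlm i)) hml fun i j hj => by
      rw [← T.2] at hj; exact (T.1.2.lt_truncLen_iff.1 hj).2⟩
  invFun T := ⟨⟨_, T.2.extend hl hml hlm⟩, by
    funext i
    refine eq_of_forall_lt_iff fun j => ?_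
    rw [(T.2.extend hl hml hlm).lt_truncLen_iff]
    constructor
    · rintro ⟨h₁, h₂⟩
      by_contra h₃
      rw [if_neg h₃, if_pos h₁] at h₂
      exact lt_irrefl _ h₂
    · intro h₁
      rw [if_pos h₁]
      exact ⟨h₁.trans_le (hml i), T.2.bound h₁⟩⟩
  left_inv := by
    rintro ⟨⟨T, hT⟩, hm⟩
    refine Subtype.ext (Subtype.ext ?_)
    funext i j
    dsimp only
    have key := hT.lt_truncLen_iff (i := i) (j := j)
    dsimp only at hm
    rw [hm] at key
    split_ifs with h₁ h₂
    · rfl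
    · have := hT.bound h₂
      have : ¬ T i j < n := fun h => h₁ (key.2 ⟨h₂, h⟩)
      omega
    · exact (hT.zeros (not_lt.1 h₂)).symm
  right_inv := by
    rintro ⟨T, hT⟩
    refine Subtype.ext ?_
    funext i j
    dsimp only
    split_ifs with h₁
    · rfl
    · exact (hT.zeros (not_lt.1 h₁)).symm

end IsSemistandard

/-- The row lengths given by `ν` read from the bottom row up, followed by empty rows. -/
def rowsOfRev {n : ℕ} (ν : Fin n → ℕ) (i : ℕ) : ℕ :=
  if h : i < n then ν (Fin.rev ⟨i, h⟩) else 0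

theorem rowsOfRev_rev {n : ℕ} (ν : Fin n → ℕ) (i : Fin n) : rowsOfRev ν (Fin.rev i) = ν i := by
  rw [rowsOfRev, dif_pos (Fin.rev i).2, Fin.eta, Fin.rev_rev]

theorem rowsOfRev_of_le {n : ℕ} (ν : Fin n → ℕ) {i : ℕ} (hi : n ≤ i) : rowsOfRev ν i = 0 :=
  dif_neg hi.not_gt

/-- The sequences, read from the bottom row up, interlacing with the row lengths `l`. -/
def interlacing (l : ℕ → ℕ) (n : ℕ) : Finset (Fin n → ℕ) :=
  Fintype.piFinset fun i => Finset.Icc (l (Fin.rev i + 1)) (l (Fin.rev i))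

section

variable {l : ℕ → ℕ} {n : ℕ} {ν : Fin n → ℕ}

theorem rowsOfRev_le (h : ν ∈ interlacing l n) (i : ℕ) : rowsOfRev ν i ≤ l i := by
  by_cases hi : i < n
  · have := (Finset.mem_Icc.1 (Fintype.mem_piFinset.1 h (Fin.rev ⟨i, hi⟩))).2
    rwa [← rowsOfRev_rev ν, Fin.rev_rev] at this
  · rw [rowsOfRev_of_le _ (not_lt.1 hi)]; exact Nat.zero_le _

theorem le_rowsOfRev (hz : ∀ i, n + 1 ≤ i → l i = 0) (h : ν ∈ interlacing l n) (i : ℕ) :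
    l (i + 1) ≤ rowsOfRev ν i := by
  by_cases hi : i < n
  · have := (Finset.mem_Icc.1 (Fintype.mem_piFinset.1 h (Fin.rev ⟨i, hi⟩))).1
    rwa [← rowsOfRev_rev ν, Fin.rev_rev] at this
  · rw [hz _ (by omega)]; exact Nat.zero_le _

/-- The shape of the entries `< n` of a semistandard filling with entries `< n + 1`. -/
def truncShape (hl : Antitone l) (T : {T // IsSemistandard l (n + 1) T}) : interlacing l n :=
  ⟨fun i => IsSemistandard.truncLen l n T.1 (Fin.rev i), Fintype.mem_piFinset.2 fun _ =>
    Finset.mem_Icc.2 ⟨T.2.le_truncLen hl _, T.2.truncLen_le _⟩⟩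

theorem truncShape_eq_iff (hl : Antitone l) (T : {T // IsSemistandard l (n + 1) T})
    (ν : interlacing l n) :
    truncShape hl T = ν ↔ IsSemistandard.truncLen l n T.1 = rowsOfRev ν.1 := by
  constructor
  · rintro rfl
    funext i
    by_cases hi : i < n
    · rw [rowsOfRev, dif_pos hi]
      simp only [truncShape, Fin.rev_rev]
    · rw [rowsOfRev_of_le _ (not_lt.1 hi), T.2.truncLen_eq_zero hl (not_lt.1 hi)]
  · intro h
    refine Subtype.ext (funext fun i => ?_)
    rw [← rowsOfRev_rev ν.1, ← h, truncShape]

/-- The branching rule: removing the largest possible entry from a semistandard filling. -/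
def branchingEquiv (hl : Antitone l) (hz : ∀ i, n + 1 ≤ i → l i = 0) :
    {T // IsSemistandard l (n + 1) T} ≃
      Σ ν : interlacing l n, {T // IsSemistandard (rowsOfRev ν.1) n T} :=
  (Equiv.sigmaFiberEquiv (truncShape hl)).symm.trans <| Equiv.sigmaCongrRight fun ν =>
    (Equiv.subtypeEquivRight fun T => truncShape_eq_iff hl T ν).trans <|
      IsSemistandard.fiberEquiv hl (rowsOfRev_le ν.2) (le_rowsOfRev hz ν.2)

end

/-- The matrix of binomial coefficients `(x i).choose j`. -/
def chooseMatrix {n : ℕ} (x : Fin n → ℕ) : Matrix (Fin n) (Fin n) ℚ :=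
  Matrix.of fun i j => ((x i).choose j : ℚ)

theorem det_chooseMatrix {n : ℕ} (x : Fin n → ℕ) :
    (∏ j : Fin n, ((j : ℕ).factorial : ℚ)) * (chooseMatrix x).det =
      ∏ i, ∏ j ∈ Finset.Ioi i, ((x j : ℚ) - x i) := by
  rw [← Matrix.det_mul_row, ← Matrix.det_vandermonde (fun i => (x i : ℚ)),
    Matrix.det_eval_matrixOfPolynomials_eq_det_vandermonde _
      (fun j : Fin n => descPochhammer ℚ j) (fun i => descPochhammer_natDegree ℚ i)
      (fun i => monic_descPochhammer ℚ i)]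
  congr 1
  ext i j
  simp [chooseMatrix, descPochhammer_eval_eq_descFactorial,
    Nat.descFactorial_eq_factorial_mul_choose]

theorem sum_Ico_choose {a b : ℕ} (h : a ≤ b) (k : ℕ) :
    ∑ m ∈ Finset.Ico a b, (m.choose k : ℚ) = b.choose (k + 1) - a.choose (k + 1) := by
  rw [← Finset.sum_Ico_sub (fun m => (m.choose (k + 1) : ℚ)) h]
  refine Finset.sum_congr rfl fun m _ => ?_
  rw [Nat.choose_succ_succ]
  push_cast
  ring

theorem det_chooseMatrix_succ {n : ℕ} (x : Fin (n + 1) → ℕ) :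
    (chooseMatrix x).det = (Matrix.of fun i j : Fin n =>
      ((x i.succ).choose (j + 1) : ℚ) - (x i.castSucc).choose (j + 1)).det := by
  have h := Matrix.det_eq_of_forall_row_eq_smul_add_pred (A := chooseMatrix x)
    (B := Matrix.of fun i j => Fin.cases (motive := fun _ => ℚ) ((x 0).choose j)
      (fun k => ((x k.succ).choose j : ℚ) - (x k.castSucc).choose j) i)
    (fun _ => 1) (fun j => by simp [chooseMatrix]) (fun i j => by simp [chooseMatrix])
  rw [h, Matrix.det_succ_column_zero, Fin.sum_univ_succ]
  simp [Matrix.submatrix]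

theorem sum_det_chooseMatrix {n : ℕ} (x : Fin (n + 1) → ℕ) (hx : Monotone x) :
    ∑ y ∈ Fintype.piFinset (fun i : Fin n => Finset.Ico (x i.castSucc) (x i.succ)),
      (chooseMatrix y).det = (chooseMatrix x).det := by
  rw [det_chooseMatrix_succ]
  have := (Matrix.detRowAlternating (n := Fin n) (R := ℚ)).toMultilinearMap.map_sum_finset
    (fun _ (m : ℕ) (j : Fin n) => (m.choose j : ℚ))
    (fun i : Fin n => Finset.Ico (x i.castSucc) (x i.succ))
  refine Eq.trans this.symm ?_
  change Matrix.det _ = _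
  congr 1
  ext i j
  rw [Finset.sum_apply, sum_Ico_choose (hx (Fin.castSucc_le_succ i))]
  rfl

theorem sum_interlacing_det {l : ℕ → ℕ} (hl : Antitone l) (n : ℕ) :
    ∑ ν ∈ interlacing l n, (chooseMatrix fun i : Fin n => ν i + i).det =
      (chooseMatrix fun i : Fin (n + 1) => l (Fin.rev i) + i).det := by
  have hx : Monotone fun i : Fin (n + 1) => l (Fin.rev i) + i := fun i j hij =>
    Nat.add_le_add (hl (Fin.rev_le_rev.2 hij)) hij
  rw [← sum_det_chooseMatrix _ hx]
  refine Finset.sum_bij (fun ν _ i => ν i + i) ?_ ?_ ?_ ?_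
  · intro ν hν
    rw [interlacing, Fintype.mem_piFinset] at hν
    rw [Fintype.mem_piFinset]
    intro i
    have := hν i
    simp only [Finset.mem_Icc, Finset.mem_Ico, Fin.rev_castSucc, Fin.rev_succ, Fin.val_succ,
      Fin.val_castSucc] at this ⊢
    omega
  · intro ν _ ν' _ h
    funext i
    exact Nat.add_right_cancel (congrFun h i)
  · intro y hy
    rw [Fintype.mem_piFinset] at hy
    have hy' : ∀ i : Fin n, l (Fin.rev i + 1) + i ≤ y i ∧ y i < l (Fin.rev i) + (i + 1) := by
      intro i
      simpa only [Finset.mem_Ico, Fin.rev_castSucc, Fin.rev_succ, Fin.val_succ,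
        Fin.val_castSucc] using hy i
    refine ⟨fun i => y i - i, ?_, ?_⟩
    · rw [interlacing, Fintype.mem_piFinset]
      intro i
      have := hy' i
      rw [Finset.mem_Icc]
      omega
    · funext i
      have := hy' i
      dsimp only
      omega
  · intro _ _
    rfl

theorem finite_and_card_isSemistandard (n : ℕ) (l : ℕ → ℕ) (hl : Antitone l)
    (hz : ∀ i, n ≤ i → l i = 0) :
    Finite {T // IsSemistandard l n T} ∧
      (Nat.card {T // IsSemistandard l n T} : ℚ) =
        (chooseMatrix fun i : Fin n => l (Fin.rev i) + i).det := by
  induction n generalizing l with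
  | zero =>
    have h0 : ∀ T, IsSemistandard l 0 T ↔ T = fun _ _ => 0 := by
      refine fun T => ⟨fun h => ?_, ?_⟩
      · funext i j
        exact h.zeros (by rw [hz i i.zero_le]; exact j.zero_le)
      · rintro rfl
        refine ⟨fun _ _ => le_rfl, fun {_ i₂ _} _ h => ?_, fun _ => rfl, fun {i _} h => ?_⟩
        · simp [hz i₂ i₂.zero_le] at h
        · simp [hz i i.zero_le] at h
    simp only [h0]
    exact ⟨inferInstance, by simp⟩
  | succ n ih =>
    have hν : ∀ ν : interlacing l n, Finite {T // IsSemistandard (rowsOfRev ν.1) n T} ∧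
        (Nat.card {T // IsSemistandard (rowsOfRev ν.1) n T} : ℚ) =
          (chooseMatrix fun i : Fin n => ν.1 i + i).det := by
      intro ν
      have := ih (rowsOfRev ν.1) (antitone_nat_of_succ_le fun i =>
        (rowsOfRev_le ν.2 (i + 1)).trans (le_rowsOfRev hz ν.2 i))
        (fun i hi => rowsOfRev_of_le _ hi)
      simpa only [rowsOfRev_rev] using this
    have := fun ν => (hν ν).1
    refine ⟨Finite.of_equiv _ (branchingEquiv hl hz).symm, ?_⟩
    rw [Nat.card_congr (branchingEquiv hl hz), Nat.card_sigma, ← sum_interlacing_det hl,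
      Nat.cast_sum]
    exact (Finset.sum_congr rfl fun ν _ => (hν ν).2).trans (Finset.sum_coe_sort (interlacing l n)
      fun ν => (chooseMatrix fun i : Fin n => ν i + i).det)

theorem YoungDiagram.colLen_eq_of_mem_Ico (μ : YoungDiagram) {n j : ℕ}
    (hj : j ∈ Finset.Ico (μ.rowLen (n + 1)) (μ.rowLen n)) : μ.colLen j = n + 1 := by
  rw [Finset.mem_Ico] at hj
  have h₁ : n < μ.colLen j :=
    YoungDiagram.mem_iff_lt_colLen.1 (YoungDiagram.mem_iff_lt_rowLen.2 hj.2)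
  have h₂ : ¬ n + 1 < μ.colLen j := fun h =>
    hj.1.not_gt (YoungDiagram.mem_iff_lt_rowLen.1 (YoungDiagram.mem_iff_lt_colLen.2 h))
  omega

theorem prod_Ico_hookLength (μ : YoungDiagram) {i n : ℕ} (hin : i ≤ n) :
    (μ.rowLen i - μ.rowLen n + (n - i)).factorial *
      ∏ j ∈ Finset.Ico (μ.rowLen (n + 1)) (μ.rowLen n), hookLength μ (i, j) =
    (μ.rowLen i - μ.rowLen (n + 1) + (n - i)).factorial := by
  have h₁ := μ.rowLen_anti i n hin
  have h₂ := μ.rowLen_anti n (n + 1) n.le_succ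
  have h₃ : ∏ j ∈ Finset.Ico (μ.rowLen (n + 1)) (μ.rowLen n), hookLength μ (i, j) =
      (μ.rowLen i - μ.rowLen n + (n - i) + 1).ascFactorial (μ.rowLen n - μ.rowLen (n + 1)) := by
    rw [Nat.ascFactorial_eq_prod_range, Finset.prod_Ico_eq_prod_range,
      ← Finset.prod_range_reflect]
    refine Finset.prod_congr rfl fun j hj => ?_
    rw [Finset.mem_range] at hj
    rw [hookLength, μ.colLen_eq_of_mem_Ico (n := n) (by rw [Finset.mem_Ico]; omega)]
    dsimp only
    omega
  rw [h₃, Nat.factorial_mul_ascFactorial]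
  congr 1
  omega

theorem prod_hookLength_mul_prod_sub (μ : YoungDiagram) {i n : ℕ} (hin : i ≤ n) :
    (∏ j ∈ Finset.Ico (μ.rowLen (n + 1)) (μ.rowLen i), hookLength μ (i, j)) *
      ∏ k ∈ Finset.Ico (i + 1) (n + 1), (μ.rowLen i - μ.rowLen k + (k - i)) =
    (μ.rowLen i - μ.rowLen (n + 1) + (n - i)).factorial := by
  induction n, hin using Nat.le_induction with
  | base => simpa using prod_Ico_hookLength μ (le_refl i)
  | succ n hin ih =>
    rw [← prod_Ico_hookLength μ (hin.trans n.le_succ), Finset.prod_Ico_succ_top (by omega),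
      ← Finset.prod_Ico_consecutive _ (μ.rowLen_anti (n + 1) (n + 2) (by omega))
        (μ.rowLen_anti i (n + 1) (by omega)),
      show n + 1 - i = n - i + 1 by omega, ← add_assoc, Nat.factorial_succ, ← ih]
    ring

theorem hookLength_pos {μ : YoungDiagram} {i j : ℕ} (h : j < μ.rowLen i) :
    0 < hookLength μ (i, j) := by
  have := YoungDiagram.mem_iff_lt_colLen.1 (YoungDiagram.mem_iff_lt_rowLen.2 h)
  simp only [hookLength]
  omega

theorem prod_row_content_div_hookLength (μ : YoungDiagram) {N i : ℕ} (hrows : μ.colLen 0 ≤ N)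
    (hi : i < N) :
    ∏ j ∈ Finset.range (μ.rowLen i), (((N : ℚ) + j - i) / hookLength μ (i, j)) =
      (∏ k ∈ Finset.Ico (i + 1) N, ((μ.rowLen i : ℚ) - μ.rowLen k + (k - i))) /
        (N - 1 - i).factorial := by
  obtain ⟨n, rfl⟩ : ∃ n, N = n + 1 := ⟨N - 1, by omega⟩
  have h0 : μ.rowLen (n + 1) = 0 := by
    by_contra h
    have := YoungDiagram.mem_iff_lt_colLen.1
      (YoungDiagram.mem_iff_lt_rowLen.2 (Nat.pos_of_ne_zero h))
    omega
  have key := prod_hookLength_mul_prod_sub μ (Nat.lt_succ_iff.1 hi)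
  rw [h0, Nat.sub_zero, Nat.Ico_zero_eq_range, add_comm (μ.rowLen i) (n - i),
    ← Nat.factorial_mul_ascFactorial, Nat.ascFactorial_eq_prod_range] at key
  have h₁ : ∏ j ∈ Finset.range (μ.rowLen i), (((n + 1 : ℕ) : ℚ) + j - i) =
      ((∏ j ∈ Finset.range (μ.rowLen i), (n - i + 1 + j) : ℕ) : ℚ) := by
    push_cast [Nat.cast_sub (Nat.lt_succ_iff.1 hi)]
    exact Finset.prod_congr rfl fun _ _ => by ring
  have h₂ : ∏ k ∈ Finset.Ico (i + 1) (n + 1), ((μ.rowLen i : ℚ) - μ.rowLen k + (k - i)) =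
      ((∏ k ∈ Finset.Ico (i + 1) (n + 1), (μ.rowLen i - μ.rowLen k + (k - i)) : ℕ) : ℚ) := by
    rw [Nat.cast_prod]
    refine Finset.prod_congr rfl fun k hk => ?_
    rw [Finset.mem_Ico] at hk
    rw [Nat.cast_add, Nat.cast_sub (μ.rowLen_anti i k (by omega)), Nat.cast_sub (by omega)]
  have h₃ : ((∏ j ∈ Finset.range (μ.rowLen i), hookLength μ (i, j) : ℕ) : ℚ) ≠ 0 :=
    Nat.cast_ne_zero.2 (Finset.prod_ne_zero_iff.2 fun j hj =>
      (hookLength_pos (Finset.mem_range.1 hj)).ne')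
  rw [Finset.prod_div_distrib, h₁, h₂, ← Nat.cast_prod, Nat.add_sub_cancel,
    div_eq_div_iff h₃ (Nat.cast_ne_zero.2 (Nat.factorial_ne_zero _)), ← Nat.cast_mul,
    ← Nat.cast_mul, mul_comm, ← key, mul_comm]

theorem prod_cells_content_div_hookLength (μ : YoungDiagram) {N : ℕ} (hrows : μ.colLen 0 ≤ N) :
    ∏ c ∈ μ.cells, (((N : ℚ) + (c.2 : ℚ) - (c.1 : ℚ)) / (hookLength μ c : ℚ)) =
      (chooseMatrix fun i : Fin N => μ.rowLen (Fin.rev i) + i).det := by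
  rw [Finset.prod_finset_product μ.cells (Finset.range N)
    (fun i => Finset.range (μ.rowLen i)) (fun p => by
      rw [YoungDiagram.mem_cells, Finset.mem_range, Finset.mem_range,
        ← YoungDiagram.mem_iff_lt_rowLen]
      refine ⟨fun h => ⟨?_, h⟩, fun h => h.2⟩
      exact (YoungDiagram.mem_iff_lt_colLen.1
        (μ.up_left_mem le_rfl (Nat.zero_le _) h)).trans_le hrows)]
  have hf : (∏ j : Fin N, ((j : ℕ).factorial : ℚ)) ≠ 0 :=
    Finset.prod_ne_zero_iff.2 fun j _ => Nat.cast_ne_zero.2 (Nat.factorial_ne_zero _)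
  refine mul_left_cancel₀ hf ?_
  rw [det_chooseMatrix, Finset.prod_congr rfl fun i hi =>
    prod_row_content_div_hookLength μ hrows (Finset.mem_range.1 hi), Finset.prod_div_distrib,
    Finset.prod_range_reflect (fun i => (i.factorial : ℚ)),
    Fin.prod_univ_eq_prod_range (fun i => (i.factorial : ℚ)), mul_div_cancel₀]
  · rw [Finset.prod_sigma', Finset.prod_sigma']
    symm
    refine Finset.prod_bij (fun p _ => ⟨(Fin.rev p.2 : ℕ), (Fin.rev p.1 : ℕ)⟩) ?_ ?_ ?_ ?_
    · rintro ⟨a, b⟩ h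
      simp only [Finset.mem_sigma, Finset.mem_univ, Finset.mem_Ioi, true_and, Finset.mem_range,
        Finset.mem_Ico, Fin.val_rev, Fin.lt_def] at h ⊢
      omega
    · rintro ⟨a, b⟩ _ ⟨c, d⟩ _ h
      simp only [Sigma.mk.injEq, Fin.val_inj, Fin.rev_inj, heq_eq_eq] at h
      rw [h.1, h.2]
    · rintro ⟨a, b⟩ h
      simp only [Finset.mem_sigma, Finset.mem_range, Finset.mem_Ico] at h
      refine ⟨⟨Fin.rev ⟨b, h.2.2⟩, Fin.rev ⟨a, h.1⟩⟩, ?_, ?_⟩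
      · simp only [Finset.mem_sigma, Finset.mem_univ, Finset.mem_Ioi, true_and, Fin.lt_def,
          Fin.val_rev]
        omega
      · simp only [Fin.rev_rev]
    · rintro ⟨a, b⟩ _
      simp only [Fin.val_rev]
      rw [Nat.cast_sub (by omega), Nat.cast_sub (by omega)]
      push_cast
      ring
  · rwa [← Fin.prod_univ_eq_prod_range (fun i => (i.factorial : ℚ))]

/-- Semistandard Young tableaux of shape `μ` with entries `< n` as fillings of the rows of `μ`. -/
def SemistandardYoungTableau.equivIsSemistandard (μ : YoungDiagram) (n : ℕ) :
    {T : SemistandardYoungTableau μ // ∀ i j : ℕ, (i, j) ∈ μ → T i j < n} ≃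
      {T // IsSemistandard μ.rowLen n T} where
  toFun T := ⟨T.1,
    { row_weak := fun h hj => T.1.row_weak h (YoungDiagram.mem_iff_lt_rowLen.2 hj)
      col_strict := fun h hj => T.1.col_strict h (YoungDiagram.mem_iff_lt_rowLen.2 hj)
      zeros := fun hj => T.1.zeros fun h => hj.not_gt (YoungDiagram.mem_iff_lt_rowLen.1 h)
      bound := fun hj => T.2 _ _ (YoungDiagram.mem_iff_lt_rowLen.2 hj) }⟩
  invFun T := ⟨
    { entry := T.1
      row_weak' := fun h hj => T.2.row_weak h (YoungDiagram.mem_iff_lt_rowLen.1 hj)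
      col_strict' := fun h hj => T.2.col_strict h (YoungDiagram.mem_iff_lt_rowLen.1 hj)
      zeros' := fun hj => T.2.zeros (not_lt.1 fun h => hj (YoungDiagram.mem_iff_lt_rowLen.2 h)) },
    fun _ _ hj => T.2.bound (YoungDiagram.mem_iff_lt_rowLen.1 hj)⟩
  left_inv _ := rfl
  right_inv _ := rfl

/-- Hook content formula.  For a partition `μ` of `L` with at most `N` rows, the Schur
polynomial evaluated at `N` ones, `s_μ(1,…,1)` — which by definition of the Schur polynomial
is the number of semistandard Young tableaux of shape `μ` with entries among `N` values
(in Mathlib's 0-based convention, entries `< N`) — satisfies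
`s_μ(1,…,1) = ∏_{(i,j)∈μ} (N + j - i) / hook_μ(i,j)`. -/
theorem stmt5 (μ : YoungDiagram) (N : ℕ) (hrows : μ.colLen 0 ≤ N) :
    (Nat.card {T : SemistandardYoungTableau μ // ∀ i j : ℕ, (i, j) ∈ μ → T i j < N} : ℚ) =
      ∏ c ∈ μ.cells, (((N : ℚ) + (c.2 : ℚ) - (c.1 : ℚ)) / (hookLength μ c : ℚ)) := by
  rw [Nat.card_congr (SemistandardYoungTableau.equivIsSemistandard μ N),
    prod_cells_content_div_hookLength μ hrows]
  refine (finite_and_card_isSemistandard N μ.rowLen (fun i j h => μ.rowLen_anti i j h)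
    fun i hi => ?_).2
  by_contra h
  have := YoungDiagram.mem_iff_lt_colLen.1
    (YoungDiagram.mem_iff_lt_rowLen.2 (Nat.pos_of_ne_zero h))
  omega
end

section
/- Wick's theorem for the GUE: for half-edge set H of even cardinality and a map h ↦ (j_h, j'_h), the Gaussian expectation ⟨Π_{h∈H} M_{j_h, j'_h}⟩ = N^{-|H|/2} Σ over fixed-point-free involutions α of H of Π_{h∈H, over pairs} δ-matchings, where each pair {h, α(h)} contributes δ_{j_h, j'_{α(h)}} δ_{j'_h, j_{α(h)}}. In particular ⟨M_{ab} M_{cd}⟩ = δ_{ad} δ_{bc}/N and all odd moments vanish. -/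
open MeasureTheory

/-- The underlying probability space of the GUE of size `N`: a family of `N²` independent
standard real Gaussians. -/
noncomputable def gueMeasure (N : ℕ) : Measure ((Fin N × Fin N) → ℝ) :=
  Measure.pi fun _ => ProbabilityTheory.gaussianReal 0 1

/-- The GUE random matrix of size `N`, with covariance `⟨M_ab M_cd⟩ = δ_ad δ_bc / N`. -/
noncomputable def gueMatrix (N : ℕ) (ω : (Fin N × Fin N) → ℝ) :
    Matrix (Fin N) (Fin N) ℂ := fun i j =>
  if i = j then (ω (i, i) : ℂ) / (Real.sqrt N : ℂ)
  else if i < j then ((ω (i, j) : ℂ) + Complex.I * (ω (j, i) : ℂ)) / (Real.sqrt (2 * N) : ℂ)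
  else ((ω (j, i) : ℂ) - Complex.I * (ω (i, j) : ℂ)) / (Real.sqrt (2 * N) : ℂ)

open ProbabilityTheory in
lemma integrable_pow_gaussianReal (n : ℕ) : Integrable (fun x : ℝ => x ^ n) (gaussianReal 0 1) := by
  rcases Nat.eq_zero_or_pos n with rfl | hn
  · simp
  · have h := (memLp_id_gaussianReal (μ := 0) (v := 1) n).integrable_norm_pow hn.ne'
    refine h.mono' (by fun_prop) (.of_forall fun x => by simp)

open ProbabilityTheory in
lemma integral_pow_succ_gaussianReal (n : ℕ) :
    ∫ x, x ^ (n + 1) ∂(gaussianReal 0 1) = n * ∫ x, x ^ (n - 1) ∂(gaussianReal 0 1) := by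
  have hint (m : ℕ) : Integrable (fun x : ℝ => x ^ m * gaussianPDFReal 0 1 x) := by
    have h := integrable_pow_gaussianReal m
    rw [gaussianReal_of_var_ne_zero _ one_ne_zero] at h
    rw [integrable_withDensity_iff (measurable_gaussianPDF 0 1)
      (.of_forall fun _ => gaussianPDF_lt_top)] at h
    simpa only [toReal_gaussianPDF] using h
  have hder (x : ℝ) :
      HasDerivAt (gaussianPDFReal 0 1) (-x * gaussianPDFReal 0 1 x) x := by
    have h : HasDerivAt (fun y : ℝ => -(y - 0) ^ 2 / (2 * ((1 : NNReal) : ℝ))) (-x) x := by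
      have := (((hasDerivAt_id x).sub_const 0).pow 2).neg.div_const (2 * ((1 : NNReal) : ℝ))
      convert! this using 1
      simp only [NNReal.coe_one, id]
      push_cast
      ring
    have := h.exp.const_mul (√(2 * Real.pi * ((1 : NNReal) : ℝ)))⁻¹
    convert! this using 1
    simp only [gaussianPDFReal]
    ring
  have hparts := integral_mul_deriv_eq_deriv_mul_of_integrable
    (u := fun x : ℝ => x ^ n) (u' := fun x => n * x ^ (n - 1))
    (v := gaussianPDFReal 0 1) (v' := fun x => -x * gaussianPDFReal 0 1 x)
    (fun x _ => hasDerivAt_pow n x) (fun x _ => hder x)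
    (by
      convert! (hint (n + 1)).neg using 1
      ext x; simp only [Pi.mul_apply, Pi.neg_apply]; ring)
    (by
      convert! (hint (n - 1)).const_mul (n : ℝ) using 1
      ext x; simp only [Pi.mul_apply]; ring)
    (hint n)
  rw [integral_gaussianReal_eq_integral_smul one_ne_zero,
    integral_gaussianReal_eq_integral_smul one_ne_zero, ← integral_const_mul]
  simp only [smul_eq_mul]
  calc ∫ x, gaussianPDFReal 0 1 x * x ^ (n + 1)
      = -∫ x, x ^ n * (-x * gaussianPDFReal 0 1 x) := by
        rw [← integral_neg]; congr 1; ext x; ring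
    _ = _ := by
        rw [hparts, neg_neg]; congr 1; ext x; ring

section Stein

variable {K : Type*} [Fintype K]

lemma eval_ofReal_monomial (s : K →₀ ℕ) (a : ℂ) (ω : K → ℝ) :
    MvPolynomial.eval (fun k => (ω k : ℂ)) (MvPolynomial.monomial s a) =
      a * ∏ k, (ω k : ℂ) ^ s k := by
  rw [MvPolynomial.eval_monomial, Finsupp.prod_fintype _ _ (by simp)]

lemma integrable_eval_gaussian (p : MvPolynomial K ℂ) :
    Integrable (fun ω : K → ℝ => MvPolynomial.eval (fun k => (ω k : ℂ)) p)
      (Measure.pi fun _ => ProbabilityTheory.gaussianReal 0 1) := by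
  induction p using MvPolynomial.induction_on' with
  | monomial s a =>
    simp_rw [eval_ofReal_monomial]
    refine Integrable.const_mul (Integrable.fintype_prod
      (f := fun k (x : ℝ) => (x : ℂ) ^ s k) fun k => ?_) a
    simpa using (integrable_pow_gaussianReal (s k)).ofReal (𝕜 := ℂ)
  | add p q hp hq =>
    simp only [map_add]
    exact hp.add hq

lemma integral_eval_monomial_gaussian (s : K →₀ ℕ) (a : ℂ) :
    ∫ ω : K → ℝ, MvPolynomial.eval (fun k => (ω k : ℂ)) (MvPolynomial.monomial s a)
      ∂(Measure.pi fun _ => ProbabilityTheory.gaussianReal 0 1) =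
      a * ∏ k, ((∫ x, x ^ s k ∂(ProbabilityTheory.gaussianReal 0 1) : ℝ) : ℂ) := by
  simp_rw [eval_ofReal_monomial]
  rw [integral_const_mul, integral_fintype_prod_eq_prod (fun k (x : ℝ) => (x : ℂ) ^ s k)]
  congr 2 with k
  rw [← integral_complex_ofReal]
  simp

/-- Gaussian integration by parts for polynomials. -/
lemma integral_eval_X_mul_gaussian (k : K) (p : MvPolynomial K ℂ) :
    ∫ ω : K → ℝ, MvPolynomial.eval (fun k => (ω k : ℂ)) (MvPolynomial.X k * p)
      ∂(Measure.pi fun _ => ProbabilityTheory.gaussianReal 0 1) =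
    ∫ ω : K → ℝ, MvPolynomial.eval (fun k => (ω k : ℂ)) (MvPolynomial.pderiv k p)
      ∂(Measure.pi fun _ => ProbabilityTheory.gaussianReal 0 1) := by
  classical
  induction p using MvPolynomial.induction_on' with
  | monomial s a =>
    rw [MvPolynomial.X, MvPolynomial.monomial_mul, MvPolynomial.pderiv_monomial,
      integral_eval_monomial_gaussian, integral_eval_monomial_gaussian, one_mul, mul_assoc,
      ← Finset.mul_prod_erase _ _ (Finset.mem_univ k),
      ← Finset.mul_prod_erase _ _ (Finset.mem_univ k)]
    have herase : ∀ i ∈ Finset.univ.erase k, (Finsupp.single k 1 + s : K →₀ ℕ) i = s i ∧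
        (s - Finsupp.single k 1 : K →₀ ℕ) i = s i := fun i hi => by
      simp [(Finset.ne_of_mem_erase hi).symm]
    let m : ℕ → ℂ := fun n => ((∫ x, x ^ n ∂(ProbabilityTheory.gaussianReal 0 1) : ℝ) : ℂ)
    have hadd := Finset.prod_congr rfl fun i hi => congrArg m (herase i hi).1
    have hsub := Finset.prod_congr rfl fun i hi => congrArg m (herase i hi).2
    simp only [m] at hadd hsub
    rw [hadd, hsub]
    simp only [Finsupp.add_apply, Finsupp.tsub_apply, Finsupp.single_eq_same]
    rw [add_comm, integral_pow_succ_gaussianReal]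
    push_cast
    ring
  | add p q hp hq =>
    simp only [mul_add, map_add] at hp hq ⊢
    rw [integral_add (integrable_eval_gaussian _) (integrable_eval_gaussian _),
      integral_add (integrable_eval_gaussian _) (integrable_eval_gaussian _), hp, hq]

end Stein

lemma Derivation.leibniz_finset_prod {R A ι : Type*} [CommSemiring R] [CommSemiring A]
    [Algebra R A] [DecidableEq ι] (D : Derivation R A A) (s : Finset ι) (f : ι → A) :
    D (∏ i ∈ s, f i) = ∑ i ∈ s, (∏ j ∈ s.erase i, f j) * D (f i) := by
  induction s using Finset.induction_on with
  | empty => simp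
  | insert a s ha ih =>
    rw [Finset.prod_insert ha, D.leibniz, ih, Finset.sum_insert ha, Finset.erase_insert ha,
      smul_eq_mul, smul_eq_mul, Finset.mul_sum, add_comm]
    congr 1
    refine Finset.sum_congr rfl fun i hi => ?_
    rw [Finset.erase_insert_of_ne (ne_of_mem_of_not_mem hi ha).symm,
      Finset.prod_insert (fun h => ha (Finset.mem_of_mem_erase h)), mul_assoc]

section Pairing

variable {H R : Type*} [Fintype H] [DecidableEq H] [CommSemiring R]

/-- The sum over perfect matchings of `s`, encoded as involutions with support `s`, of the
product of the weights `w h (α h)` over `h ∈ s`. -/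
def pairingSum (w : H → H → R) (s : Finset H) : R :=
  ∑ α ∈ Finset.univ.filter (fun α : Equiv.Perm H => α * α = 1 ∧ ∀ h, α h ≠ h ↔ h ∈ s),
    ∏ h ∈ s, w h (α h)

lemma pairingSum_empty (w : H → H → R) : pairingSum w ∅ = 1 := by
  have : Finset.univ.filter
      (fun α : Equiv.Perm H => α * α = 1 ∧ ∀ h, α h ≠ h ↔ h ∈ (∅ : Finset H)) = {1} := by
    ext α
    simp only [Finset.mem_filter, Finset.mem_univ, true_and, Finset.notMem_empty, iff_false,
      not_not, Finset.mem_singleton]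
    exact ⟨fun h => Equiv.ext h.2, fun h => by simp [h]⟩
  rw [pairingSum, this, Finset.sum_singleton, Finset.prod_empty]

lemma pairingSum_insert (w : H → H → R) {a : H} {s : Finset H} (ha : a ∉ s) :
    pairingSum w (insert a s) = ∑ b ∈ s, w a b * w b a * pairingSum w (s.erase b) := by
  simp only [pairingSum, Finset.mul_sum]
  rw [Finset.sum_sigma']
  refine Finset.sum_bij' (fun α _ => ⟨α a, Equiv.swap a (α a) * α⟩)
    (fun x _ => Equiv.swap a x.1 * x.2) ?_ ?_ ?_ ?_ ?_
  · intro α hα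
    simp only [Finset.mem_filter, Finset.mem_univ, true_and, Finset.mem_sigma] at hα ⊢
    obtain ⟨h1, h2⟩ := hα
    have h1' : ∀ x, α (α x) = x := fun x => by simpa using congrArg (· x) h1
    have haa := (h2 a).2 (by simp)
    have key : ∀ x, (Equiv.swap a (α a) * α) x = if x = a ∨ x = α a then x else α x := by
      intro x
      simp only [Equiv.Perm.mul_apply, Equiv.swap_apply_def]
      have := h1' x; have := h1' a
      grind
    refine ⟨?_, ?_, ?_⟩
    · have := h2 (α a); grind
    · ext x
      rw [Equiv.Perm.mul_apply, key, key]
      have := h1' x; have := h1' a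
      simp only [Equiv.Perm.one_apply]
      grind
    · intro x
      rw [key]
      have := h2 x
      simp only [Finset.mem_erase, Finset.mem_insert] at this ⊢
      grind
  · rintro ⟨b, β⟩ hx
    simp only [Finset.mem_filter, Finset.mem_univ, true_and, Finset.mem_sigma] at hx ⊢
    obtain ⟨hb, h1, h2⟩ := hx
    have h1' : ∀ x, β (β x) = x := fun x => by simpa using congrArg (· x) h1
    have hba : β a = a := by have := h2 a; grind
    have hbb : β b = b := by have := h2 b; grind
    have hab : a ≠ b := by grind
    have key : ∀ x, (Equiv.swap a b * β) x = if x = a then b else if x = b then a else β x := by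
      intro x
      simp only [Equiv.Perm.mul_apply, Equiv.swap_apply_def]
      have := h1' x
      grind
    refine ⟨?_, ?_⟩
    · ext x
      rw [Equiv.Perm.mul_apply, key, key]
      have := h1' x
      simp only [Equiv.Perm.one_apply]
      grind
    · intro x
      rw [key]
      have := h2 x
      simp only [Finset.mem_erase, Finset.mem_insert] at this ⊢
      grind
  · intro α _
    simp [← mul_assoc]
  · rintro ⟨b, β⟩ hx
    simp only [Finset.mem_filter, Finset.mem_univ, true_and, Finset.mem_sigma] at hx
    obtain ⟨hb, h1, h2⟩ := hx
    have hba : β a = a := by have := h2 a; grind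
    have : (Equiv.swap a b * β) a = b := by simp [hba]
    simp only [this]
    simp [← mul_assoc]
  · intro α hα
    simp only [Finset.mem_filter, Finset.mem_univ, true_and] at hα
    obtain ⟨h1, h2⟩ := hα
    have h1' : ∀ x, α (α x) = x := fun x => by simpa using congrArg (· x) h1
    have haa := (h2 a).2 (by simp)
    have hs : α a ∈ s := by have := h2 (α a); grind
    rw [Finset.prod_insert ha, ← Finset.mul_prod_erase _ _ hs, h1', ← mul_assoc]
    congr 1
    refine Finset.prod_congr rfl fun x hx => ?_
    congr 1
    have hxa : α x ≠ a := by have := h1' x; grind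
    have hxb : α x ≠ α a := by have := h1' x; have := h1' a; grind
    rw [Equiv.Perm.mul_apply, Equiv.swap_apply_of_ne_of_ne hxa hxb]

lemma pairingSum_univ (w : H → H → R) :
    pairingSum w Finset.univ =
      ∑ α ∈ Finset.univ.filter (fun α : Equiv.Perm H => α * α = 1 ∧ ∀ h, α h ≠ h),
        ∏ h, w h (α h) := by
  simp [pairingSum]

end Pairing

/-- Isserlis' theorem for complex linear combinations of independent standard Gaussians, the
covariance being factored as `w a b * w b a`. -/
theorem integral_prod_linear_gaussian {K H : Type*} [Fintype K] [Fintype H] [DecidableEq H]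
    (l : H → K → ℂ) (w : H → H → ℂ) (hw : ∀ a b, ∑ k, l a k * l b k = w a b * w b a)
    (s : Finset H) :
    ∫ ω : K → ℝ, ∏ h ∈ s, ∑ k, l h k * (ω k : ℂ)
      ∂(Measure.pi fun _ => ProbabilityTheory.gaussianReal 0 1) = pairingSum w s := by
  classical
  let L : H → MvPolynomial K ℂ := fun h => ∑ k, l h k • MvPolynomial.X k
  have hL (t : Finset H) (ω : K → ℝ) : ∏ h ∈ t, ∑ k, l h k * (ω k : ℂ) =
      MvPolynomial.eval (fun k => (ω k : ℂ)) (∏ h ∈ t, L h) := by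
    simp [L, map_prod, MvPolynomial.smul_eval]
  have hD (a b : H) :
      ∑ k, l a k • MvPolynomial.pderiv k (L b) = MvPolynomial.C (w a b * w b a) := by
    simp [L, ← hw, MvPolynomial.smul_eq_C_mul, Pi.single_apply]
  induction s using Finset.strongInduction with
  | H s ih =>
    rcases s.eq_empty_or_nonempty with rfl | ⟨a, ha⟩
    · simp [pairingSum_empty]
    obtain ⟨t, hat, rfl⟩ : ∃ t, a ∉ t ∧ insert a t = s :=
      ⟨s.erase a, by simp, Finset.insert_erase ha⟩
    rw [pairingSum_insert w hat]
    have hpoly : ∑ k, l a k • MvPolynomial.pderiv k (∏ h ∈ t, L h) =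
        ∑ b ∈ t, (w a b * w b a) • ∏ h ∈ t.erase b, L h := by
      simp_rw [Derivation.leibniz_finset_prod, Finset.smul_sum]
      rw [Finset.sum_comm]
      refine Finset.sum_congr rfl fun b _ => ?_
      rw [MvPolynomial.smul_eq_C_mul, ← hD, mul_comm, Finset.mul_sum]
      exact Finset.sum_congr rfl fun k _ => (mul_smul_comm _ _ _).symm
    calc _ = ∑ k, l a k * ∫ ω : K → ℝ,
          MvPolynomial.eval (fun k => (ω k : ℂ)) (MvPolynomial.X k * ∏ h ∈ t, L h)
          ∂(Measure.pi fun _ => ProbabilityTheory.gaussianReal 0 1) := by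
          simp_rw [← integral_const_mul]
          rw [← integral_finsetSum _ fun k _ => (integrable_eval_gaussian _).const_mul _]
          congr 1 with ω
          rw [Finset.prod_insert hat, hL, Finset.sum_mul]
          simp [mul_assoc]
      _ = ∫ ω : K → ℝ, MvPolynomial.eval (fun k => (ω k : ℂ))
          (∑ k, l a k • MvPolynomial.pderiv k (∏ h ∈ t, L h))
          ∂(Measure.pi fun _ => ProbabilityTheory.gaussianReal 0 1) := by
          simp_rw [integral_eval_X_mul_gaussian, ← integral_const_mul]
          rw [← integral_finsetSum _ fun k _ => (integrable_eval_gaussian _).const_mul _]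
          simp [MvPolynomial.smul_eval]
      _ = ∑ b ∈ t, w a b * w b a * pairingSum w (t.erase b) := by
          simp_rw [hpoly, map_sum, MvPolynomial.smul_eval]
          rw [integral_finsetSum _ fun k _ => (integrable_eval_gaussian _).const_mul _]
          refine Finset.sum_congr rfl fun b hb => ?_
          rw [integral_const_mul, ← ih (t.erase b)
            ((Finset.erase_ssubset hb).trans (Finset.ssubset_insert hat))]
          simp_rw [hL]

/-- The coefficients of the entry `(i, j)` of the GUE matrix as a linear form in the underlying
standard Gaussians. -/
noncomputable def gueCoeff (N : ℕ) (i j : Fin N) : Fin N × Fin N → ℂ :=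
  if i = j then Pi.single (i, i) (Real.sqrt N : ℂ)⁻¹
  else if i < j then
    Pi.single (i, j) (Real.sqrt (2 * N) : ℂ)⁻¹ +
      Pi.single (j, i) (Complex.I * (Real.sqrt (2 * N) : ℂ)⁻¹)
  else
    Pi.single (j, i) (Real.sqrt (2 * N) : ℂ)⁻¹ -
      Pi.single (i, j) (Complex.I * (Real.sqrt (2 * N) : ℂ)⁻¹)

lemma gueMatrix_eq_sum (N : ℕ) (ω : Fin N × Fin N → ℝ) (i j : Fin N) :
    gueMatrix N ω i j = ∑ k, gueCoeff N i j k * (ω k : ℂ) := by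
  change _ = gueCoeff N i j ⬝ᵥ fun k => (ω k : ℂ)
  unfold gueMatrix gueCoeff
  split_ifs
  · simp [div_eq_inv_mul]
  · simp only [add_dotProduct, single_dotProduct]
    ring
  · simp only [sub_dotProduct, single_dotProduct]
    ring

lemma ofReal_sqrt_natCast_inv_mul_self (n : ℕ) :
    (Real.sqrt n : ℂ)⁻¹ * (Real.sqrt n : ℂ)⁻¹ = (n : ℂ)⁻¹ := by
  rw [← mul_inv, ← Complex.ofReal_mul, Real.mul_self_sqrt n.cast_nonneg, Complex.ofReal_natCast]

lemma sum_gueCoeff_mul_gueCoeff (N : ℕ) (a b c d : Fin N) :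
    ∑ k, gueCoeff N a b k * gueCoeff N c d k =
      if a = d ∧ b = c then (N : ℂ)⁻¹ else 0 := by
  change gueCoeff N a b ⬝ᵥ gueCoeff N c d = _
  have h1 := ofReal_sqrt_natCast_inv_mul_self N
  have h2 : (Real.sqrt (2 * N) : ℂ)⁻¹ * (Real.sqrt (2 * N) : ℂ)⁻¹ = (N : ℂ)⁻¹ / 2 := by
    have := ofReal_sqrt_natCast_inv_mul_self (2 * N)
    push_cast at this
    rw [this, mul_inv]
    ring
  unfold gueCoeff
  generalize (Real.sqrt N : ℂ)⁻¹ = r at *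
  generalize (Real.sqrt (2 * N) : ℂ)⁻¹ = q at *
  generalize (N : ℂ)⁻¹ = v at *
  have hI := Complex.I_mul_I
  generalize Complex.I = I at *
  rcases lt_trichotomy a b with hab | rfl | hab <;> rcases lt_trichotomy c d with hcd | rfl | hcd
  all_goals
    simp only [lt_irrefl, if_true, if_false, *, ne_of_lt, ne_of_gt, not_lt_of_gt, add_dotProduct,
      sub_dotProduct, single_dotProduct, Pi.add_apply, Pi.sub_apply, Pi.single_apply,
      Prod.mk.injEq]
    grind

lemma integral_prod_gueMatrix (N : ℕ) {H : Type*} [Fintype H] [DecidableEq H] (j j' : H → Fin N)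
    (s : Finset H) :
    ∫ ω, (∏ h ∈ s, gueMatrix N ω (j h) (j' h)) ∂(gueMeasure N) =
      pairingSum (fun a b => 1 / (Real.sqrt N : ℂ) * if j a = j' b then 1 else 0) s := by
  simp_rw [gueMatrix_eq_sum, gueMeasure]
  refine integral_prod_linear_gaussian _ _ (fun a b => ?_) s
  rw [sum_gueCoeff_mul_gueCoeff, ← ofReal_sqrt_natCast_inv_mul_self]
  simp only [one_div]
  grind

/-- Wick's theorem for the GUE: for a finite set `H` of half-edges and index maps
`h ↦ (j_h, j'_h)`, the Gaussian expectation satisfies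
`⟨∏_{h∈H} M_{j_h, j'_h}⟩ = N^{-|H|/2} ∑_α ∏_{h∈H} δ_{j_h, j'_{α(h)}}`,
the sum being over fixed-point-free involutions `α` of `H` (each pair `{h, α(h)}` contributing
`δ_{j_h, j'_{α(h)}} δ_{j'_h, j_{α(h)}}`, i.e. the product over all `h` of `δ_{j_h, j'_{α(h)}}`).
In particular `⟨M_ab M_cd⟩ = δ_ad δ_bc / N`, and all odd moments vanish (for odd `|H|` there
are no fixed-point-free involutions, so both sides are `0`). -/
theorem stmt17 (N : ℕ) (hN : 0 < N) (H : Type*) [Fintype H] [DecidableEq H]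
    (j j' : H → Fin N) :
    ((∫ ω, (∏ h, gueMatrix N ω (j h) (j' h)) ∂(gueMeasure N)) =
      ((1 : ℂ) / (Real.sqrt N : ℂ)) ^ (Fintype.card H) *
        ∑ α ∈ Finset.univ.filter (fun α : Equiv.Perm H => α * α = 1 ∧ ∀ h, α h ≠ h),
          ∏ h, (if j h = j' (α h) then (1 : ℂ) else 0)) ∧
    (∀ a b c d : Fin N,
      (∫ ω, gueMatrix N ω a b * gueMatrix N ω c d ∂(gueMeasure N)) =
        if a = d ∧ b = c then (1 : ℂ) / (N : ℂ) else 0) := by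
  constructor
  · rw [integral_prod_gueMatrix, pairingSum_univ, Finset.mul_sum]
    simp only [Finset.prod_mul_distrib, Finset.prod_const, Finset.card_univ]
  · intro a b c d
    have h := integral_prod_gueMatrix N (fun i : Bool => bif i then a else c)
      (fun i => bif i then b else d) {true, false}
    rw [pairingSum_insert _ (by simp)] at h
    simp only [Finset.mem_singleton, Bool.true_eq_false, not_false_eq_true, Finset.prod_insert,
      Finset.prod_singleton, Finset.sum_singleton, cond_true, cond_false, Finset.erase_singleton,
      pairingSum_empty, mul_one] at h
    rw [h, one_div (N : ℂ), ← ofReal_sqrt_natCast_inv_mul_self]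
    simp only [one_div]
    grind
end
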